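/- Let R be a commutative Noetherian local ring and M a finitely generated R-module such that Ext^i_R(M,R) = 0 for all i ≥ 1 and M has finite reducing Gorenstein dimension. Then M is torsionless, i.e., the natural evaluation map M → Hom_R(Hom_R(M,R),R) is injective. -/

import Mathlib

open CategoryTheory

universe u

variable (R : Type u) [CommRing R]

/-- `SES R A B C` : there is a short exact sequence `0 → A → B → C → 0` of `R`-modules. -/
def SES (A B C : ModuleCat.{u} R) : Prop :=
  ∃ (f : A →ₗ[R] B) (g : B →ₗ[R] C),
    Function.Injective f ∧ Function.Surjective g ∧ LinearMap.range f = LinearMap.ker g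

/-- A finitely generated free module. -/
def IsFinFree (F : ModuleCat.{u} R) : Prop :=
  Module.Finite R F ∧ Module.Free R F

/-- `IsSyzygy R n S K` : `S` is an `n`-th syzygy of `K`, i.e. there is an exact sequence
`0 → S → F_{n-1} → ⋯ → F_0 → K → 0` with each `F_j` finitely generated free
(for `n = 0` this just means `S ≅ K`). -/
def IsSyzygy : ℕ → ModuleCat.{u} R → ModuleCat.{u} R → Prop
  | 0, S, K => Nonempty (S ≃ₗ[R] K)
  | n + 1, S, K => ∃ T F : ModuleCat.{u} R, IsSyzygy n T K ∧ IsFinFree R F ∧ SES R S F T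

/-- The direct sum `M^{⊕ a}`. -/
def MPow (M : ModuleCat.{u} R) (a : ℕ) : ModuleCat.{u} R := ModuleCat.of R (Fin a → M)

/-- `IsReducingSeq R K` : the finitely generated modules `K 0, …, K r` form a reducing
sequence, i.e. there are positive integers `a i, b i, n i` and short exact sequences
`0 → (K i)^{⊕ a i} → K (i+1) → S i → 0` where `S i` is an `(n i)`-th syzygy
of `(K i)^{⊕ b i}`. -/
def IsReducingSeq {r : ℕ} (K : Fin (r + 1) → ModuleCat.{u} R) : Prop :=
  (∀ i, Module.Finite R (K i)) ∧
  ∃ a b n : Fin r → ℕ,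
    (∀ i, 0 < a i) ∧ (∀ i, 0 < b i) ∧ (∀ i, 0 < n i) ∧
    ∀ i : Fin r, ∃ S : ModuleCat.{u} R,
      IsSyzygy R (n i) S (MPow R (K i.castSucc) (b i)) ∧
      SES R (MPow R (K i.castSucc) (a i)) (K i.succ) S

/-- `ExtVanishes R M N i` : the `R`-module `Ext^i_R(M, N)` is zero. -/
def ExtVanishes (M N : ModuleCat.{u} R) (i : ℕ) : Prop :=
  Subsingleton (((Ext R (ModuleCat.{u} R) i).obj (Opposite.op M)).obj N)

/-- A totally reflexive module. -/
def IsTotallyReflexive (M : ModuleCat.{u} R) : Prop :=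
  Function.Bijective (Module.Dual.eval R M) ∧
  ∀ i : ℕ, 1 ≤ i →
    ExtVanishes R M (ModuleCat.of R R) i ∧
    ExtVanishes R (ModuleCat.of R (Module.Dual R M)) (ModuleCat.of R R) i

/-- `ResolvedBy R P m M` : there is an exact sequence `0 → G_m → ⋯ → G_0 → M → 0`
in which each `G_j` satisfies `P`. -/
def ResolvedBy (P : ModuleCat.{u} R → Prop) : ℕ → ModuleCat.{u} R → Prop
  | 0, M => ∃ G : ModuleCat.{u} R, P G ∧ Nonempty (G ≃ₗ[R] M)
  | m + 1, M => ∃ G S : ModuleCat.{u} R, P G ∧ SES R S G M ∧ ResolvedBy P m S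

/-- Finite Gorenstein dimension. -/
def FiniteGdim (M : ModuleCat.{u} R) : Prop :=
  ∃ m : ℕ, ResolvedBy R (IsTotallyReflexive R) m M

/-- Finite projective dimension. -/
def FinitePd (M : ModuleCat.{u} R) : Prop :=
  ∃ m : ℕ, ResolvedBy R (fun G => Module.Projective R G) m M

/-- `HasRedSeqTo R P M` : `M` admits a reducing sequence `K_0 = M, K_1, …, K_r`
whose last module `K_r` satisfies `P`. -/
def HasRedSeqTo (P : ModuleCat.{u} R → Prop) (M : ModuleCat.{u} R) : Prop :=
  ∃ (r : ℕ) (K : Fin (r + 1) → ModuleCat.{u} R),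
    K 0 = M ∧ IsReducingSeq R K ∧ P (K (Fin.last r))

/-- Finite reducing Gorenstein dimension. -/
def FiniteRedGdim (M : ModuleCat.{u} R) : Prop :=
  HasRedSeqTo R (FiniteGdim R) M

/-- Finite reducing projective dimension. -/
def FiniteRedPd (M : ModuleCat.{u} R) : Prop :=
  HasRedSeqTo R (FinitePd R) M

namespace TorsionlessAux

lemma extVanishes_iff (R : Type u) [CommRing R] (M N : ModuleCat.{u} R) (n : ℕ) :
    ExtVanishes R M N (n + 1) ↔ Subsingleton (Abelian.Ext.{u} M N (n + 1)) := by
  let P : ProjectiveResolution M := projectiveResolution M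
  have h1 : ExtVanishes R M N (n + 1) ↔
      ∀ f : P.complex.X (n + 1) ⟶ N, P.complex.d (n + 2) (n + 1) ≫ f = 0 →
        ∃ g : P.complex.X n ⟶ N, P.complex.d (n + 1) n ≫ g = f := by
    unfold ExtVanishes
    rw [← ModuleCat.isZero_iff_subsingleton, (P.isoExt (R := R) (n + 1) N).isZero_iff,
      ← HomologicalComplex.exactAt_iff_isZero_homology,
      HomologicalComplex.exactAt_iff' _ n (n + 1) (n + 2) (by simp) (by simp),
      ShortComplex.moduleCat_exact_iff]
    rfl
  rw [h1]
  constructor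
  · intro h
    refine ⟨fun a b => ?_⟩
    have key : ∀ a : Abelian.Ext.{u} M N (n + 1), a = 0 := by
      intro a
      obtain ⟨f, hf, rfl⟩ := P.extMk_surjective a (n + 2) rfl
      exact (P.extMk_eq_zero_iff f (n + 2) rfl hf n rfl).2 (h f hf)
    rw [key a, key b]
  · intro h f hf
    exact (P.extMk_eq_zero_iff f (n + 2) rfl hf n rfl).1 (Subsingleton.elim _ _)

/-- All positive `Ext^i(M, R)` vanish. -/
def EV (R : Type u) [CommRing R] (M : ModuleCat.{u} R) : Prop :=
  ∀ n : ℕ, Subsingleton (Abelian.Ext.{u} M (ModuleCat.of R R) (n + 1))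

variable {R}

lemma EV_iff (M : ModuleCat.{u} R) :
    EV R M ↔ ∀ i : ℕ, 1 ≤ i → ExtVanishes R M (ModuleCat.of R R) i := by
  constructor
  · intro h i hi
    obtain ⟨n, rfl⟩ := Nat.exists_eq_add_of_le' hi
    exact (extVanishes_iff R _ _ n).2 (h n)
  · intro h n
    exact (extVanishes_iff R _ _ n).1 (h _ (by omega))

lemma shortExact {A B C : ModuleCat.{u} R} (f : A →ₗ[R] B) (g : B →ₗ[R] C)
    (hf : Function.Injective f) (hg : Function.Surjective g)
    (h : LinearMap.range f = LinearMap.ker g) :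
    ∃ S : ShortComplex (ModuleCat.{u} R), S.ShortExact ∧
      S = ShortComplex.mk (ModuleCat.ofHom f) (ModuleCat.ofHom g) (by
        ext x
        have : f x ∈ LinearMap.ker g := h ▸ LinearMap.mem_range_self f x
        simpa using this) := by
  refine ⟨_, ?_, rfl⟩
  refine ShortComplex.ShortExact.mk' ?_ ?_ ?_
  · rw [ShortComplex.moduleCat_exact_iff_range_eq_ker]
    exact h
  · exact (ModuleCat.mono_iff_injective _).2 hf
  · exact (ModuleCat.epi_iff_surjective _).2 hg

lemma EV_left {A B C : ModuleCat.{u} R} (h : SES R A B C) (hB : EV R B) (hC : EV R C) :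
    EV R A := by
  obtain ⟨f, g, hf, hg, e⟩ := h
  obtain ⟨S, hS, rfl⟩ := shortExact f g hf hg e
  intro n
  have := hB n
  have := hC (n + 1)
  refine subsingleton_of_forall_eq 0 fun x => ?_
  obtain ⟨y, rfl⟩ := Abelian.Ext.contravariant_sequence_exact₁ hS _ x (n₁ := n + 1 + 1)
    (by omega) (Subsingleton.elim (α := Abelian.Ext.{u} C (ModuleCat.of R R) (n + 1 + 1)) _ _)
  rw [Subsingleton.elim (α := Abelian.Ext.{u} B (ModuleCat.of R R) (n + 1)) y 0]
  simp

lemma EV_mid {A B C : ModuleCat.{u} R} (h : SES R A B C) (hA : EV R A) (hC : EV R C) :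
    EV R B := by
  obtain ⟨f, g, hf, hg, e⟩ := h
  obtain ⟨S, hS, rfl⟩ := shortExact f g hf hg e
  intro n
  have := hA n
  have := hC n
  refine subsingleton_of_forall_eq 0 fun x => ?_
  obtain ⟨y, rfl⟩ := Abelian.Ext.contravariant_sequence_exact₂ hS _ x
    (Subsingleton.elim (α := Abelian.Ext.{u} A (ModuleCat.of R R) (n + 1)) _ _)
  rw [Subsingleton.elim (α := Abelian.Ext.{u} C (ModuleCat.of R R) (n + 1)) y 0]
  simp

lemma exists_extend {A B C : ModuleCat.{u} R} (f : A →ₗ[R] B) (g : B →ₗ[R] C)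
    (hf : Function.Injective f) (hg : Function.Surjective g)
    (e : LinearMap.range f = LinearMap.ker g) (hC : EV R C) (φ : A →ₗ[R] R) :
    ∃ ψ : B →ₗ[R] R, ∀ a, ψ (f a) = φ a := by
  obtain ⟨S, hS, rfl⟩ := shortExact f g hf hg e
  have := hC 0
  obtain ⟨y, hy⟩ := Abelian.Ext.contravariant_sequence_exact₁ hS (ModuleCat.of R R)
    (Abelian.Ext.mk₀ (ModuleCat.ofHom φ : A ⟶ ModuleCat.of R R)) (n₁ := 0 + 1)
    (by omega) (Subsingleton.elim (α := Abelian.Ext.{u} C (ModuleCat.of R R) (0 + 1)) _ _)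
  obtain ⟨ψ, rfl⟩ := (Abelian.Ext.mk₀_bijective _ _).2 y
  rw [Abelian.Ext.mk₀_comp_mk₀] at hy
  have h2 := (Abelian.Ext.mk₀_bijective _ _).1 hy
  refine ⟨ModuleCat.Hom.hom ψ, fun a => ?_⟩
  exact congrArg (fun t : A ⟶ ModuleCat.of R R => ModuleCat.Hom.hom t a) h2

lemma EV_projective (P : ModuleCat.{u} R) [hP : Module.Projective R P] : EV R P := by
  rw [EV_iff]
  intro i hi
  obtain ⟨n, rfl⟩ := Nat.exists_eq_add_of_le' hi
  have : Projective P := (IsProjective.iff_projective P).1 hP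
  exact ModuleCat.isZero_iff_subsingleton.1 (isZero_Ext_succ_of_projective (R := R) P _ n)

lemma EV_iso {A B : ModuleCat.{u} R} (e : A ≃ₗ[R] B) (hB : EV R B) : EV R A := by
  refine EV_left (C := ModuleCat.of R PUnit.{u+1}) ⟨e.toLinearMap, 0, e.injective, ?_, ?_⟩ hB
    (EV_projective _)
  · exact fun x => ⟨0, Subsingleton.elim (α := PUnit.{u+1}) _ _⟩
  · simp

lemma EV_MPow {M : ModuleCat.{u} R} (hM : EV R M) (a : ℕ) : EV R (MPow R M a) := by
  induction a with
  | zero =>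
    have : Module.Projective R (MPow R M 0) := by
      have : Subsingleton (MPow R M 0) := inferInstanceAs (Subsingleton (Fin 0 → M))
      infer_instance
    exact EV_projective _
  | succ a ih =>
    refine EV_mid (A := M) (C := MPow R M a)
      ⟨(LinearMap.single R (fun _ : Fin (a + 1) => (M : Type u)) 0 : M →ₗ[R] (Fin (a + 1) → M)),
        (LinearMap.funLeft R M (Fin.succ : Fin a → Fin (a + 1))), ?_, ?_, ?_⟩ hM ih
    · exact Pi.single_injective (M := fun _ : Fin (a + 1) => (M : Type u)) 0
    · exact LinearMap.funLeft_surjective_of_injective R M _ (Fin.succ_injective a)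
    · ext x
      constructor
      · rintro ⟨m, rfl⟩
        change LinearMap.funLeft R M Fin.succ (Pi.single 0 m) = 0
        ext j
        simp [LinearMap.funLeft]
      · intro hx
        change LinearMap.funLeft R M Fin.succ x = 0 at hx
        refine ⟨(x : Fin (a + 1) → M) 0, ?_⟩
        change (Pi.single 0 ((x : Fin (a + 1) → M) 0) : Fin (a + 1) → M) = x
        ext j
        refine Fin.cases ?_ (fun j => ?_) j
        · simp
        · rw [Pi.single_eq_of_ne (Fin.succ_ne_zero j)]
          exact (congrFun hx j).symm

lemma EV_syzygy : ∀ (n : ℕ) {S K : ModuleCat.{u} R}, IsSyzygy R n S K → EV R K → EV R S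
  | 0, _, _, ⟨e⟩, hK => EV_iso e hK
  | n + 1, _, _, ⟨T, F, hT, hF, h⟩, hK => by
    have := hF.2
    exact EV_left h (EV_projective F) (EV_syzygy n hT hK)

/-- Totally reflexive, in terms of `EV`. -/
def TR (M : ModuleCat.{u} R) : Prop :=
  Function.Bijective (Module.Dual.eval R M) ∧ EV R M ∧ EV R (ModuleCat.of R (Module.Dual R M))

lemma TR_iff (M : ModuleCat.{u} R) : IsTotallyReflexive R M ↔ TR M := by
  unfold IsTotallyReflexive TR
  rw [EV_iff, EV_iff]
  exact and_congr_right fun _ => ⟨fun h => ⟨fun i hi => (h i hi).1, fun i hi => (h i hi).2⟩,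
    fun h i hi => ⟨h.1 i hi, h.2 i hi⟩⟩

lemma TR_step {S G K : ModuleCat.{u} R} (h : SES R S G K) (hS : TR S) (hG : TR G)
    (hK : EV R K) : TR K := by
  obtain ⟨f, g, hf, hg, e⟩ := h
  have hgf : ∀ s, g (f s) = 0 := fun s => by
    have : f s ∈ LinearMap.ker g := e ▸ LinearMap.mem_range_self f s
    exact this
  have ginj : Function.Injective g.dualMap := LinearMap.dualMap_injective_of_surjective hg
  have fsurj : Function.Surjective f.dualMap := fun φ => by
    obtain ⟨ψ, hψ⟩ := exists_extend f g hf hg e hK φ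
    exact ⟨ψ, LinearMap.ext hψ⟩
  have ed : LinearMap.range g.dualMap = LinearMap.ker f.dualMap := by
    ext φ
    constructor
    · rintro ⟨k, rfl⟩
      rw [LinearMap.mem_ker]
      ext s
      simp [hgf]
    · intro hφ
      have hφ' : LinearMap.ker g ≤ LinearMap.ker φ := by
        rw [← e]
        rintro _ ⟨s, rfl⟩
        exact LinearMap.congr_fun (LinearMap.mem_ker.1 hφ) s
      refine ⟨(LinearMap.ker g).liftQ φ hφ' ∘ₗ (g.quotKerEquivOfSurjective hg).symm, ?_⟩
      ext x
      have : (g.quotKerEquivOfSurjective hg).symm (g x) = (LinearMap.ker g).mkQ x := by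
        rw [LinearEquiv.symm_apply_eq]; rfl
      simp [this]
  have hd : SES R (ModuleCat.of R (Module.Dual R K)) (ModuleCat.of R (Module.Dual R G))
      (ModuleCat.of R (Module.Dual R S)) := ⟨g.dualMap, f.dualMap, ginj, fsurj, ed⟩
  refine ⟨⟨?_, ?_⟩, hK, EV_left hd hG.2.2 hS.2.2⟩
  · rw [injective_iff_map_eq_zero]
    intro k hk
    obtain ⟨x, rfl⟩ := hg k
    have hk' : LinearMap.ker f.dualMap ≤ LinearMap.ker (Module.Dual.eval R G x) := by
      rw [← ed]
      rintro _ ⟨φ, rfl⟩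
      exact LinearMap.congr_fun hk φ
    obtain ⟨s, hs⟩ := hS.1.2 ((LinearMap.ker f.dualMap).liftQ (Module.Dual.eval R G x) hk' ∘ₗ
      (f.dualMap.quotKerEquivOfSurjective fsurj).symm)
    have : f s = x := by
      apply hG.1.1
      ext φ
      have h1 := LinearMap.congr_fun hs (f.dualMap φ)
      have h2 : (f.dualMap.quotKerEquivOfSurjective fsurj).symm (f.dualMap φ)
          = (LinearMap.ker f.dualMap).mkQ φ := by
        rw [LinearEquiv.symm_apply_eq]; rfl
      simp only [LinearMap.comp_apply, LinearEquiv.coe_coe, h2] at h1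
      simpa using h1
    rw [← this, hgf]
  · intro η
    obtain ⟨ψ, hψ⟩ := exists_extend (A := ModuleCat.of R (Module.Dual R K))
      (B := ModuleCat.of R (Module.Dual R G)) (C := ModuleCat.of R (Module.Dual R S))
      g.dualMap f.dualMap ginj fsurj ed hS.2.2 η
    obtain ⟨x, hx⟩ := hG.1.2 ψ
    refine ⟨g x, ?_⟩
    ext φ
    rw [← hψ φ, ← hx]
    rfl

lemma TR_zero : TR (ModuleCat.of R PUnit.{u+1}) := by
  have : Subsingleton (Module.Dual R PUnit.{u+1}) := ⟨fun a b => by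
    ext x
    rw [Subsingleton.elim x 0, map_zero, map_zero]⟩
  refine ⟨⟨fun _ _ _ => Subsingleton.elim (α := PUnit.{u+1}) _ _, fun η => ⟨0, ?_⟩⟩,
    EV_projective _, ?_⟩
  · ext φ
    have : φ = 0 := Subsingleton.elim (α := Module.Dual R PUnit.{u+1}) _ _
    rw [this]; simp
  · have : Module.Projective R (ModuleCat.of R (Module.Dual R PUnit.{u+1})) :=
      inferInstanceAs (Module.Projective R (Module.Dual R PUnit.{u+1}))
    exact EV_projective _

lemma TR_of_resolved : ∀ (m : ℕ) {M : ModuleCat.{u} R},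
    ResolvedBy R (IsTotallyReflexive R) m M → EV R M → TR M
  | 0, M, ⟨G, hG, ⟨e⟩⟩, hM => by
    refine TR_step (S := ModuleCat.of R PUnit.{u+1}) ⟨0, e.toLinearMap, ?_, e.surjective, ?_⟩
      TR_zero ((TR_iff G).1 hG) hM
    · exact fun _ _ _ => Subsingleton.elim (α := PUnit.{u+1}) _ _
    · simp
  | m + 1, M, ⟨G, S, hG, h, hS⟩, hM => by
    have hG' := (TR_iff G).1 hG
    exact TR_step h (TR_of_resolved m hS (EV_left h hG'.2.1 hM)) hG' hM

lemma injective_eval_of_injective {A B : ModuleCat.{u} R} (f : A →ₗ[R] B)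
    (hf : Function.Injective f) (hB : Function.Injective (Module.Dual.eval R B)) :
    Function.Injective (Module.Dual.eval R A) := by
  intro x y hxy
  apply hf
  apply hB
  ext φ
  exact LinearMap.congr_fun hxy (φ ∘ₗ f)

lemma injective_eval_MPow {A B : ModuleCat.{u} R} {a : ℕ} (ha : 0 < a)
    (f : MPow R A a →ₗ[R] B)
    (hf : Function.Injective f) (hB : Function.Injective (Module.Dual.eval R B)) :
    Function.Injective (Module.Dual.eval R A) := by
  let s : A →ₗ[R] MPow R A a :=
    (LinearMap.single R (fun _ : Fin a => (A : Type u)) ⟨0, ha⟩ : A →ₗ[R] (Fin a → A))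
  have hs : Function.Injective s :=
    Pi.single_injective (M := fun _ : Fin a => (A : Type u)) ⟨0, ha⟩
  exact injective_eval_of_injective (f ∘ₗ s) (hf.comp hs) hB

end TorsionlessAux

open TorsionlessAux in
theorem torsionless_of_finiteRedGdim_of_ext_vanishing
    (R : Type u) [CommRing R] [IsNoetherianRing R] [IsLocalRing R]
    (M : ModuleCat.{u} R) (hM : Module.Finite R M)
    (hext : ∀ i : ℕ, 1 ≤ i → ExtVanishes R M (ModuleCat.of R R) i)
    (hred : FiniteRedGdim R M) :
    Function.Injective (Module.Dual.eval R (M : Type u)) := by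
  obtain ⟨r, K, rfl, ⟨-, a, b, n, ha, -, -, hK⟩, ⟨m, hm⟩⟩ := hred
  have hEV : ∀ i : Fin (r + 1), EV R (K i) := by
    intro i
    induction i using Fin.induction with
    | zero => exact (EV_iff _).2 hext
    | succ i ih =>
      obtain ⟨S, hS, h⟩ := hK i
      exact EV_mid h (EV_MPow ih _) (EV_syzygy _ hS (EV_MPow ih _))
  have hinj : ∀ i : Fin (r + 1), Function.Injective (Module.Dual.eval R (K i)) := by
    intro i
    induction i using Fin.reverseInduction with
    | last => exact (TR_of_resolved m hm (hEV _)).1.1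
    | cast i ih =>
      obtain ⟨S, hS, f, g, hf, -, -⟩ := hK i
      exact injective_eval_MPow (ha i) f hf ih
  exact hinj 0
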